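/- The grid graph P_6 □ P_6 is not efficiently dominatable and its efficient domination number equals 33. -/

import Mathlib

open SimpleGraph

/-- The closed neighborhood `N[v]` of a vertex. -/
def closedNbhd {V : Type*} (G : SimpleGraph V) (v : V) : Set V :=
  insert v (G.neighborSet v)

/-- `S` is an efficient dominating set: `|N[v] ∩ S| = 1` for every vertex `v`. -/
def isEDS {V : Type*} (G : SimpleGraph V) (S : Set V) : Prop :=
  ∀ v : V, ∃! u : V, u ∈ S ∧ u ∈ closedNbhd G v

/-- `S` is a 2-packing: closed neighborhoods of distinct members are disjoint. -/
def twoPacking {V : Type*} (G : SimpleGraph V) (S : Set V) : Prop :=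
  S.Pairwise fun u v => Disjoint (closedNbhd G u) (closedNbhd G v)

/-- The influence of `S`: the number of vertices dominated by `S`. -/
noncomputable def influence {V : Type*} (G : SimpleGraph V) (S : Set V) : ℕ :=
  (⋃ v ∈ S, closedNbhd G v).ncard

/-- The efficient domination number `F(G)`: maximum influence of a 2-packing. -/
noncomputable def effDomNum {V : Type*} (G : SimpleGraph V) : ℕ :=
  sSup {n | ∃ S : Set V, twoPacking G S ∧ influence G S = n}

/-- Boolean membership test for closed neighborhoods in the grid. -/
def nbT (v w : Fin 6 × Fin 6) : Bool :=
  Nat.ble ((v.1.val - w.1.val) + (w.1.val - v.1.val) + ((v.2.val - w.2.val) + (w.2.val - v.2.val))) 1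

lemma mem_closedNbhd_iff (v w : Fin 6 × Fin 6) :
    w ∈ closedNbhd (pathGraph 6 □ pathGraph 6) v ↔ nbT v w = true := by
  obtain ⟨⟨a, ha⟩, ⟨b, hb⟩⟩ := v
  obtain ⟨⟨c, hc⟩, ⟨d, hd⟩⟩ := w
  simp only [closedNbhd, Set.mem_insert_iff, mem_neighborSet, boxProd_adj, pathGraph_adj, nbT,
    Nat.ble_eq, Prod.mk.injEq, Fin.mk.injEq]
  omega

/-- The closed neighborhood as a bit mask. -/
def maskOf (v : Fin 6 × Fin 6) : ℕ :=
  let c := 6 * v.1.val + v.2.val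
  2 ^ c + (if v.1.val = 0 then 0 else 2 ^ (c - 6)) + (if v.1.val = 5 then 0 else 2 ^ (c + 6))
    + (if v.2.val = 0 then 0 else 2 ^ (c - 1)) + (if v.2.val = 5 then 0 else 2 ^ (c + 1))

/-- The size of the closed neighborhood. -/
def sizeOfN (v : Fin 6 × Fin 6) : ℕ :=
  1 + (if v.1.val = 0 then 0 else 1) + (if v.1.val = 5 then 0 else 1)
    + (if v.2.val = 0 then 0 else 1) + (if v.2.val = 5 then 0 else 1)

/-- Exhaustive search over all packings. -/
def srch : List (ℕ × ℕ) → ℕ → ℕ → Bool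
  | [], _, c => Nat.ble c 33
  | p :: l, occ, c =>
    match Nat.land occ p.1 with
    | 0 => (srch l (Nat.lor occ p.1) (Nat.add c p.2)).and (srch l occ c)
    | _ + 1 => srch l occ c

lemma srch_spec (l : List (ℕ × ℕ)) : ∀ (occ c : ℕ), srch l occ c = true →
    ∀ s : List (ℕ × ℕ), s.Sublist l → s.Pairwise (fun p q => p.1 &&& q.1 = 0) →
      (∀ p ∈ s, occ &&& p.1 = 0) → c + (s.map Prod.snd).sum ≤ 33 := by
  induction l with
  | nil =>
    intro occ c h s hs _ _
    have := List.sublist_nil.mp hs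
    subst this
    simpa [srch] using h
  | cons p l ih =>
    intro occ c h s hs hp ho
    rw [srch] at h
    have h2 : srch l occ c = true := by
      split at h
      · simp only [Bool.and_eq_true] at h
        exact h.2
      · exact h
    cases hs with
    | cons _ hs => exact ih occ c h2 s hs hp ho
    | cons_cons _ hs =>
      rename_i s
      have h0 : Nat.land occ p.1 = 0 := ho p (by simp)
      rw [h0] at h
      simp only [Bool.and_eq_true] at h
      rw [List.pairwise_cons] at hp
      have := ih _ _ h.1 s hs hp.2 (by
        intro q hq
        change (occ ||| p.1) &&& q.1 = 0
        rw [Nat.and_or_distrib_right, hp.1 q hq, ho q (by simp [hq])]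
        rfl)
      simp only [List.map_cons, List.sum_cons]
      change c + p.2 + _ ≤ 33 at this
      omega

/-- All the cells, in row-major order. -/
def cells : List (Fin 6 × Fin 6) := List.product (List.finRange 6) (List.finRange 6)

/-- The search table. -/
def tbl : List (ℕ × ℕ) := cells.map fun v => (maskOf v, sizeOfN v)

/-- The evaluated search table. -/
def tblLit : List (ℕ × ℕ) := [
  (67, 3), (135, 4), (270, 4), (540, 4), (1080, 4), (2096, 3),
  (4289, 4), (8642, 5), (17284, 5), (34568, 5), (69136, 5), (134176, 4),
  (274496, 4), (553088, 5), (1106176, 5), (2212352, 5), (4424704, 5), (8587264, 4),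
  (17567744, 4), (35397632, 5), (70795264, 5), (141590528, 5), (283181056, 5), (549584896, 4),
  (1124335616, 4), (2265448448, 5), (4530896896, 5), (9061793792, 5), (18123587584, 5), (35173433344, 4),
  (3238002688, 3), (7549747200, 4), (15099494400, 4), (30198988800, 4), (60397977600, 4), (52076478464, 3)]

lemma tbl_eq : tbl = tblLit := by decide +kernel

lemma srch_true : srch tblLit 0 0 = true := by decide +kernel

lemma mask_disj : ∀ u v : Fin 6 × Fin 6, maskOf u &&& maskOf v = 0 ∨
    ∃ w, nbT u w = true ∧ nbT v w = true := by decide +kernel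

lemma size_eq : ∀ v : Fin 6 × Fin 6,
    (Finset.univ.filter fun w => nbT v w = true).card = sizeOfN v := by decide +kernel

lemma cells_nodup : cells.Nodup := by decide +kernel

lemma mem_cells : ∀ v, v ∈ cells := by decide +kernel

lemma union_eq (S : Finset (Fin 6 × Fin 6)) :
    (⋃ v ∈ (S : Set (Fin 6 × Fin 6)), closedNbhd (pathGraph 6 □ pathGraph 6) v) =
      ((S.biUnion fun v => Finset.univ.filter fun w => nbT v w = true : Finset _) : Set _) := by
  ext w
  simp [mem_closedNbhd_iff]

lemma influence_eq (S : Finset (Fin 6 × Fin 6)) :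
    influence (pathGraph 6 □ pathGraph 6) (S : Set _) =
      (S.biUnion fun v => Finset.univ.filter fun w => nbT v w = true).card := by
  rw [influence, union_eq, Set.ncard_coe_finset]

lemma upper (S : Set (Fin 6 × Fin 6)) (hS : twoPacking (pathGraph 6 □ pathGraph 6) S) :
    influence (pathGraph 6 □ pathGraph 6) S ≤ 33 := by
  classical
  obtain ⟨T, rfl⟩ : ∃ T : Finset (Fin 6 × Fin 6), S = T := ⟨S.toFinite.toFinset, by simp⟩
  rw [influence_eq]
  refine Finset.card_biUnion_le.trans ?_
  simp only [size_eq]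
  set F := cells.filter (fun v => decide (v ∈ T)) with hF
  have hFn : F.Nodup := cells_nodup.filter _
  have hFT : F.toFinset = T := by
    ext v
    simp [hF, mem_cells]
  have hsub : (F.map fun v => (maskOf v, sizeOfN v)).Sublist tblLit := by
    rw [← tbl_eq]
    exact List.Sublist.map _ List.filter_sublist
  have key := srch_spec tblLit 0 0 srch_true _ hsub (by
    rw [List.pairwise_map]
    refine List.Pairwise.imp_of_mem ?_ hFn
    intro u v hu hv huv
    rcases mask_disj u v with h | ⟨w, h1, h2⟩
    · exact h
    · exfalso
      have hu' : u ∈ T := by simpa [hF, mem_cells] using hu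
      have hv' : v ∈ T := by simpa [hF, mem_cells] using hv
      have hd := hS (Finset.mem_coe.2 hu') (Finset.mem_coe.2 hv') huv
      exact Set.disjoint_left.mp hd ((mem_closedNbhd_iff u w).2 h1) ((mem_closedNbhd_iff v w).2 h2))
    (by simp)
  rw [← hFT, List.sum_toFinset _ hFn]
  rw [List.map_map] at key
  simpa [Function.comp_def] using key

/-- An optimal packing. -/
def optS : Finset (Fin 6 × Fin 6) :=
  {(0, 3), (1, 0), (1, 5), (2, 2), (3, 4), (4, 0), (5, 2), (5, 5)}

lemma optS_disj : ∀ u ∈ optS, ∀ v ∈ optS, u ≠ v → ∀ w, nbT u w = true → ¬ nbT v w = true := by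
  decide +kernel

lemma optS_card :
    (optS.biUnion fun v => Finset.univ.filter fun w => nbT v w = true).card = 33 := by
  decide +kernel

lemma nbT_symm : ∀ u v, nbT u v = nbT v u := by decide +kernel

theorem stmt10 :
    (¬ ∃ S : Set (Fin 6 × Fin 6), isEDS (pathGraph 6 □ pathGraph 6) S) ∧
    effDomNum (pathGraph 6 □ pathGraph 6) = 33 := by
  constructor
  · rintro ⟨S, hS⟩
    have hp : twoPacking (pathGraph 6 □ pathGraph 6) S := by
      intro u hu v hv huv
      refine Set.disjoint_left.mpr fun w h1 h2 => huv ?_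
      rw [mem_closedNbhd_iff, nbT_symm, ← mem_closedNbhd_iff] at h1 h2
      exact (hS w).unique ⟨hu, h1⟩ ⟨hv, h2⟩
    have h33 := upper S hp
    have hU : (⋃ v ∈ S, closedNbhd (pathGraph 6 □ pathGraph 6) v) = Set.univ := by
      refine Set.eq_univ_of_forall fun w => ?_
      obtain ⟨u, ⟨hu, h1⟩, -⟩ := hS w
      rw [mem_closedNbhd_iff, nbT_symm, ← mem_closedNbhd_iff] at h1
      exact Set.mem_biUnion hu h1
    rw [influence, hU, Set.ncard_univ] at h33
    simp at h33
  · have hG : IsGreatest {n | ∃ S : Set (Fin 6 × Fin 6),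
        twoPacking (pathGraph 6 □ pathGraph 6) S ∧
          influence (pathGraph 6 □ pathGraph 6) S = n} 33 := by
      refine ⟨⟨(optS : Set _), ?_, ?_⟩, ?_⟩
      · intro u hu v hv huv
        refine Set.disjoint_left.mpr fun w h1 h2 => ?_
        rw [mem_closedNbhd_iff] at h1 h2
        exact optS_disj u (Finset.mem_coe.1 hu) v (Finset.mem_coe.1 hv) huv w h1 h2
      · rw [influence_eq, optS_card]
      · rintro n ⟨S, hS, rfl⟩
        exact upper S hS
    exact hG.csSup_eq
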